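/- arXiv:0712.2254 — 2 statements merged into one kernel-verified Lean document; each statement's English description precedes it below -/
import Mathlib

section
/- Let M be a finite monoid, let φ : M → G be a surjective monoid homomorphism onto a finite group G, and let e be an idempotent of the minimal ideal of M. Then φ maps the maximal subgroup G_e of M at e onto all of G. -/
/-- An ideal of a monoid `M`: a nonempty subset closed under left and right
multiplication by arbitrary elements of `M`. -/
def IsIdeal {M : Type*} [Monoid M] (I : Set M) : Prop :=
  I.Nonempty ∧ ∀ m : M, ∀ x ∈ I, m * x ∈ I ∧ x * m ∈ I

/-- A minimal ideal of a monoid `M`: an ideal contained in every ideal of `M`. -/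
def IsMinimalIdeal {M : Type*} [Monoid M] (I : Set M) : Prop :=
  IsIdeal I ∧ ∀ J : Set M, IsIdeal J → I ⊆ J

/-- The maximal subgroup of a monoid `M` at an idempotent `e`: the group of units
of the monoid `eMe` (with identity `e`). -/
def maxSubgroup {M : Type*} [Monoid M] (e : M) : Set M :=
  {x | (∃ m, x = e * m * e) ∧ ∃ y, (∃ m, y = e * m * e) ∧ x * y = e ∧ y * x = e}

/-- In a finite monoid, one-sided inverses relative to an idempotent are two-sided. -/
theorem mul_eq_idempotent_symm {M : Type*} [Monoid M] [Finite M] {e a c : M}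
    (hae : a * e = a) (hec : e * c = c) (h : a * c = e) (he : e * e = e) : c * a = e := by
  let F : {z : M // e * z = z} → {z : M // e * z = z} :=
    fun z => ⟨c * z.1, by rw [← mul_assoc, hec]⟩
  have hF : Function.Injective F := by
    intro z w hzw
    have hcz : c * z.1 = c * w.1 := congrArg Subtype.val hzw
    have haz : a * c * z.1 = a * c * w.1 := by rw [mul_assoc, hcz, mul_assoc]
    rw [h, z.2, w.2] at haz
    exact Subtype.ext haz
  obtain ⟨⟨z, hez⟩, hz⟩ := Finite.surjective_of_injective hF ⟨e, he⟩
  have hcz : c * z = e := congrArg Subtype.val hz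
  have hza : z = a := by rw [← hez, ← h, mul_assoc, hcz, hae]
  rw [← hza, hcz]

theorem isIdeal_setOf_mul_mul {M : Type*} [Monoid M] (x : M) :
    IsIdeal {z | ∃ a b, z = a * x * b} := by
  refine ⟨⟨x, 1, 1, by simp⟩, ?_⟩
  rintro m _ ⟨a, b, rfl⟩
  exact ⟨⟨m * a, b, by simp only [mul_assoc]⟩, ⟨a, b * m, by simp only [mul_assoc]⟩⟩

/-- For `e` an idempotent of the minimal ideal of a finite monoid `M`, every element of `eMe`
is a unit of `eMe`. -/
theorem IsMinimalIdeal.mul_mul_mem_maxSubgroup {M : Type*} [Monoid M] [Finite M] {I : Set M}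
    (hI : IsMinimalIdeal I) {e : M} (heI : e ∈ I) (he : e * e = e) (m : M) :
    e * m * e ∈ maxSubgroup e := by
  obtain ⟨a, b, hab⟩ := hI.2 _ (isIdeal_setOf_mul_mul (e * m * e)) heI
  have hee (z : M) : e * (e * z) = e * z := by rw [← mul_assoc, he]
  have hright : (e * a * e) * ((e * m * e) * (e * b * e)) = e := by
    calc _ = e * (a * (e * m * e) * b) * e := by simp only [mul_assoc, hee]
      _ = e := by rw [← hab, he, he]
  have hleft : (e * m * e) * (e * b * e) * (e * a * e) = e :=
    mul_eq_idempotent_symm (by simp only [mul_assoc, he])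
      (by simp only [mul_assoc, hee]) hright he
  have hinv : (e * b * e) * (e * a * e) * (e * m * e) = e :=
    mul_eq_idempotent_symm (by simp only [mul_assoc, he])
      (by simp only [mul_assoc, hee]) (by rw [← mul_assoc, hleft]) he
  exact ⟨⟨m, rfl⟩, (e * b * e) * (e * a * e), ⟨b * e * a, by simp only [mul_assoc, hee]⟩,
    by rw [← mul_assoc, hleft], hinv⟩

/-- If `M` is a finite monoid, `φ : M → G` a surjective monoid homomorphism onto a
finite group `G`, and `e` an idempotent of the minimal ideal of `M`, then `φ` maps
the maximal subgroup of `M` at `e` onto all of `G`. -/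
theorem maxSubgroup_maps_onto_group {M G : Type*} [Monoid M] [Finite M]
    [Group G] [Finite G] (φ : M →* G) (hφ : Function.Surjective φ)
    (I : Set M) (hI : IsMinimalIdeal I) (e : M) (heI : e ∈ I) (he : e * e = e) :
    φ '' maxSubgroup e = Set.univ := by
  refine Set.eq_univ_of_forall fun g => ?_
  obtain ⟨m, rfl⟩ := hφ g
  have hφe : φ e = 1 := mul_eq_left.mp (by rw [← map_mul, he])
  exact ⟨e * m * e, hI.mul_mul_mem_maxSubgroup heI he m, by simp [hφe]⟩
end

section
/- In this setting, for every natural number j with 1 ≤ j ≤ m − 1: the element x^j * y * x^(n−j) is an idempotent of M, and the element z := y * x^j * y * x^(n−j) * y satisfies z = ((fun b => Y b * Y j * Y (n−j)), (fun _ => 0)) and in particular z.1 0 = h j (here j and n−j are interpreted in ZMod n). -/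
/-- The wreath product `H ≀ (B, T_B)` of a monoid `H` with the full transformation
monoid on `B`: pairs `(f, t)` with `f : B → H`, `t : B → B`, multiplication
`(f, s) * (g, t) = ((fun b => f b * g (s b)), (fun b => t (s b)))`. -/
structure Wreath (H B : Type*) where
  f : B → H
  t : B → B

instance {H B : Type*} [Monoid H] : Monoid (Wreath H B) where
  mul a b := ⟨fun i => a.f i * b.f (a.t i), fun i => b.t (a.t i)⟩
  one := ⟨fun _ => 1, id⟩
  mul_assoc a b c := by
    show Wreath.mk _ _ = Wreath.mk _ _
    congr 1
    · funext i; exact mul_assoc _ _ _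
  one_mul a := by
    show Wreath.mk _ _ = _
    cases a
    congr 1
    funext i; exact one_mul _
  mul_one a := by
    show Wreath.mk _ _ = _
    cases a
    congr 1
    funext i; exact mul_one _

namespace Wreath

variable {H B : Type*} [Monoid H]

theorem mk_mul_mk (f g : B → H) (s t : B → B) :
    (⟨f, s⟩ * ⟨g, t⟩ : Wreath H B) = ⟨fun i => f i * g (s i), fun i => t (s i)⟩ := rfl

theorem one_def : (1 : Wreath H B) = ⟨fun _ => 1, id⟩ := rfl

theorem mk_one_add_one_pow {R : Type*} [AddMonoidWithOne R] (k : ℕ) :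
    (⟨fun _ => 1, fun i => i + 1⟩ : Wreath H R) ^ k = ⟨fun _ => 1, fun i => i + k⟩ := by
  induction k with
  | zero => simp [one_def, Function.id_def]
  | succ k ih => simp [pow_succ, ih, mk_mul_mk, add_assoc]

end Wreath

/-- In the two-generated submonoid `M = ⟨x, y⟩` of `H ≀ (ZMod n, T_{ZMod n})`,
for `1 ≤ j ≤ m - 1` the element `x^j * y * x^(n-j)` is an idempotent of `M`, and
`z = y * x^j * y * x^(n-j) * y` equals `((fun b => Y b * Y j * Y (n-j)), 0̄)`;
in particular `z.f 0 = h j`. -/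
theorem idempotent_products_in_two_generated_wreath {H : Type*} [Group H] [Fintype H]
    (m : ℕ) (hm : m = Fintype.card H) (hm1 : 0 < m)
    (h : Fin m → H) (hbij : Function.Bijective h) (h0 : h ⟨0, hm1⟩ = 1)
    (n : ℕ) (hn1 : 1 ≤ n) (hnm : 2 * m - 1 ≤ n)
    (Y : ZMod n → H)
    (hY : ∀ j : ZMod n, Y j = if hj : j.val < m then h ⟨j.val, hj⟩ else 1)
    (x y : Wreath H (ZMod n))
    (hx : x = ⟨fun _ => 1, fun i => i + 1⟩)
    (hy : y = ⟨Y, fun _ => (0 : ZMod n)⟩)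
    (j : ℕ) (hj1 : 1 ≤ j) (hj2 : j ≤ m - 1) :
    x ^ j * y * x ^ (n - j) ∈ Submonoid.closure ({x, y} : Set (Wreath H (ZMod n))) ∧
    (x ^ j * y * x ^ (n - j)) * (x ^ j * y * x ^ (n - j)) = x ^ j * y * x ^ (n - j) ∧
    y * x ^ j * y * x ^ (n - j) * y =
      ⟨fun b => Y b * Y ((j : ZMod n)) * Y (((n - j : ℕ) : ZMod n)), fun _ => (0 : ZMod n)⟩ ∧
    (y * x ^ j * y * x ^ (n - j) * y).f 0 = h ⟨j, by omega⟩ := by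
  have hjn : j < n := by omega
  have hY0 : Y 0 = 1 := by
    rw [hY, dif_pos (by simpa using hm1)]
    simpa using h0
  have hYj : Y (j : ZMod n) = h ⟨j, by omega⟩ := by
    have hval : (j : ZMod n).val = j := ZMod.val_cast_of_lt hjn
    rw [hY, dif_pos (by omega)]
    simp only [hval]
  have hYnj : Y ((n - j : ℕ) : ZMod n) = 1 := by
    rw [hY, ZMod.val_cast_of_lt (by omega), dif_neg (by omega)]
  have hsum : ((n - j : ℕ) : ZMod n) + j = 0 := by
    rw [← Nat.cast_add, Nat.sub_add_cancel hjn.le, ZMod.natCast_self]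
  have hz : y * x ^ j * y * x ^ (n - j) * y =
      ⟨fun b => Y b * Y (j : ZMod n) * Y ((n - j : ℕ) : ZMod n), fun _ => (0 : ZMod n)⟩ := by
    simp only [hx, hy, Wreath.mk_one_add_one_pow, Wreath.mk_mul_mk, mul_one, zero_add]
  refine ⟨?_, ?_, hz, ?_⟩
  · have hxM : x ∈ Submonoid.closure ({x, y} : Set (Wreath H (ZMod n))) :=
      Submonoid.subset_closure (by simp)
    have hyM : y ∈ Submonoid.closure ({x, y} : Set (Wreath H (ZMod n))) :=
      Submonoid.subset_closure (by simp)
    exact mul_mem (mul_mem (pow_mem hxM _) hyM) (pow_mem hxM _)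
  · simp only [hx, hy, Wreath.mk_one_add_one_pow, Wreath.mk_mul_mk, mul_one, one_mul, zero_add,
      hsum, hY0]
  · simp only [hz, hY0, hYj, hYnj, one_mul, mul_one]
end
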